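/- For all a, b, m, k ∈ O with b ≠ 0 and k ≠ 0: if m*a + b = k, then (inv k * m) * (−(a * inv b)) + inv b = inv k. (This expresses that the map σ : (a,b) ↦ (−a·b⁻¹, b⁻¹), [m,k] ↦ [k⁻¹·m, k⁻¹] of Section 5.1 of the paper preserves the incidence relation of the octonion plane on points of the first type and lines of the first type.) -/

import Mathlib

noncomputable section

open Quaternion

/-- Multiplication of the Cayley–Dickson double `O = D × D` of the quaternion algebra `D`. -/
def omul {k₀ : Type*} [Field k₀] {c₁ c₂ : k₀} (β : k₀)
    (x y : ℍ[k₀,c₁,c₂] × ℍ[k₀,c₁,c₂]) : ℍ[k₀,c₁,c₂] × ℍ[k₀,c₁,c₂] :=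
  (x.1 * y.1 - β • (y.2 * star x.2), y.1 * x.2 + star x.1 * y.2)

/-- Conjugation of the Cayley–Dickson double. -/
def oconj {k₀ : Type*} [Field k₀] {c₁ c₂ : k₀}
    (x : ℍ[k₀,c₁,c₂] × ℍ[k₀,c₁,c₂]) : ℍ[k₀,c₁,c₂] × ℍ[k₀,c₁,c₂] :=
  (star x.1, -x.2)

/-- The inverse `inv x = N(x)⁻¹ • conj x` in the Cayley–Dickson double, where
`N(x₁,x₂) = n(x₁) + β·n(x₂)` and `n` is the quaternion norm. -/
def oinv {k₀ : Type*} [Field k₀] {c₁ c₂ : k₀} (β : k₀) (n : ℍ[k₀,c₁,c₂] → k₀)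
    (x : ℍ[k₀,c₁,c₂] × ℍ[k₀,c₁,c₂]) : ℍ[k₀,c₁,c₂] × ℍ[k₀,c₁,c₂] :=
  (n x.1 + β * n x.2)⁻¹ • oconj x

def qn {k₀ : Type*} [Field k₀] {c₁ c₂ : k₀} (x : ℍ[k₀,c₁,c₂]) : k₀ :=
  x.re * x.re - c₁ * (x.imI * x.imI) - c₂ * (x.imJ * x.imJ) + c₁ * c₂ * (x.imK * x.imK)

def oN {k₀ : Type*} [Field k₀] {c₁ c₂ : k₀} (β : k₀) (x : ℍ[k₀,c₁,c₂] × ℍ[k₀,c₁,c₂]) : k₀ :=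
  qn x.1 + β * qn x.2

section aux
variable {k₀ : Type*} [Field k₀] {c₁ c₂ : k₀} (β : k₀)

theorem omul_add_left' (x y z : ℍ[k₀,c₁,c₂] × ℍ[k₀,c₁,c₂]) :
    omul β (x + y) z = omul β x z + omul β y z := by
  ext <;> simp [omul] <;> ring

theorem omul_smul_left' (t : k₀) (x z : ℍ[k₀,c₁,c₂] × ℍ[k₀,c₁,c₂]) :
    omul β (t • x) z = t • omul β x z := by
  ext <;> simp [omul] <;> ring

theorem omul_smul_right' (t : k₀) (x z : ℍ[k₀,c₁,c₂] × ℍ[k₀,c₁,c₂]) :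
    omul β x (t • z) = t • omul β x z := by
  ext <;> simp [omul] <;> ring

theorem omul_neg_right' (x z : ℍ[k₀,c₁,c₂] × ℍ[k₀,c₁,c₂]) :
    omul β x (-z) = - omul β x z := by
  ext <;> simp [omul] <;> ring

theorem oconj_add' (x y : ℍ[k₀,c₁,c₂] × ℍ[k₀,c₁,c₂]) :
    oconj (x + y) = oconj x + oconj y := by
  ext <;> simp [oconj] <;> ring

set_option maxHeartbeats 4000000 in
theorem moufang' (b m a : ℍ[k₀,c₁,c₂] × ℍ[k₀,c₁,c₂]) :
    omul β (omul β b m) (omul β a b) = omul β (omul β b (omul β m a)) b := by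
  ext <;> simp only [omul, QuaternionAlgebra.re_add, QuaternionAlgebra.imI_add, QuaternionAlgebra.imJ_add, QuaternionAlgebra.imK_add, QuaternionAlgebra.re_sub, QuaternionAlgebra.imI_sub, QuaternionAlgebra.imJ_sub, QuaternionAlgebra.imK_sub, QuaternionAlgebra.re_neg, QuaternionAlgebra.imI_neg, QuaternionAlgebra.imJ_neg, QuaternionAlgebra.imK_neg, QuaternionAlgebra.re_mul, QuaternionAlgebra.imI_mul, QuaternionAlgebra.imJ_mul, QuaternionAlgebra.imK_mul, QuaternionAlgebra.re_star, QuaternionAlgebra.imI_star, QuaternionAlgebra.imJ_star, QuaternionAlgebra.imK_star, QuaternionAlgebra.re_smul, QuaternionAlgebra.imI_smul, QuaternionAlgebra.imJ_smul, QuaternionAlgebra.imK_smul, smul_eq_mul, zero_mul, add_zero] <;> ring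

theorem conj_mul_mul' (m a : ℍ[k₀,c₁,c₂] × ℍ[k₀,c₁,c₂]) :
    omul β (oconj (omul β m a)) m = oN β m • oconj a := by
  ext <;> simp [omul, oconj, oN, qn] <;> ring

theorem conj_mul_cancel' (a x : ℍ[k₀,c₁,c₂] × ℍ[k₀,c₁,c₂]) :
    omul β (oconj a) (omul β a x) = oN β a • x := by
  ext <;> simp [omul, oconj, oN, qn] <;> ring

set_option maxHeartbeats 4000000 in
theorem oN_mul' (m a : ℍ[k₀,c₁,c₂] × ℍ[k₀,c₁,c₂]) :
    oN β (omul β m a) = oN β m * oN β a := by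
  simp [omul, oN, qn]; ring

set_option maxHeartbeats 4000000 in
theorem triple' (p b : ℍ[k₀,c₁,c₂] × ℍ[k₀,c₁,c₂]) :
    omul β (omul β (oconj b) p) (oconj b)
      = (oN β (p + b) - oN β p - oN β b) • oconj b - oN β b • oconj p := by
  ext <;> simp [omul, oconj, oN, qn] <;> ring

theorem key' (m a b : ℍ[k₀,c₁,c₂] × ℍ[k₀,c₁,c₂]) :
    omul β (omul β (oconj (omul β m a + b)) m) (omul β a (oconj b))
      = oN β (omul β m a + b) • oconj b - oN β b • oconj (omul β m a + b) := by
  rw [oconj_add', omul_add_left', omul_add_left', conj_mul_mul', omul_smul_left',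
    conj_mul_cancel', moufang', triple', oN_mul']
  module

theorem n_eq' (n : ℍ[k₀,c₁,c₂] → k₀) (hn : ∀ a : ℍ[k₀,c₁,c₂], a * star a = n a • 1 ∧ star a * a = n a • 1) (x : ℍ[k₀,c₁,c₂]) : n x = qn x := by
  have h := congrArg (fun q : ℍ[k₀,c₁,c₂] => q.re) (hn x).1
  simp at h
  rw [← h, qn]; ring

end aux

/-- the map `σ : (a,b) ↦ (-a·b⁻¹, b⁻¹), [m,k] ↦ [k⁻¹·m, k⁻¹]` preserves the
incidence relation on points and lines of the first type:
if `m·a + b = k` then `(k⁻¹·m)·(-(a·b⁻¹)) + b⁻¹ = k⁻¹`. -/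
theorem σ_preserves_incidence {k₀ : Type*} [Field k₀] (c₁ c₂ : k₀) (β : k₀) (hβ : β ≠ 0)
    (n : ℍ[k₀,c₁,c₂] → k₀)
    (hn : ∀ a : ℍ[k₀,c₁,c₂], a * star a = n a • 1 ∧ star a * a = n a • 1)
    (haniso : ∀ x : ℍ[k₀,c₁,c₂] × ℍ[k₀,c₁,c₂], n x.1 + β * n x.2 = 0 → x = 0) :
    ∀ a b m km : ℍ[k₀,c₁,c₂] × ℍ[k₀,c₁,c₂], b ≠ 0 → km ≠ 0 →
      omul β m a + b = km →
      omul β (omul β (oinv β n km) m) (-(omul β a (oinv β n b))) + oinv β n b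
        = oinv β n km := by
  intro a b m km hb hk h
  have hN : ∀ x : ℍ[k₀,c₁,c₂] × ℍ[k₀,c₁,c₂], n x.1 + β * n x.2 = oN β x := by
    intro x
    rw [n_eq' n hn, n_eq' n hn, oN]
  have hb' : oN β b ≠ 0 := fun h0 => hb (haniso b (by rw [hN, h0]))
  have hk' : oN β km ≠ 0 := fun h0 => hk (haniso km (by rw [hN, h0]))
  have key := key' β m a b
  rw [h] at key
  unfold oinv
  rw [hN, hN, omul_neg_right', omul_smul_left', omul_smul_left', omul_smul_right',
    omul_smul_right', key, smul_sub, smul_sub]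
  simp only [smul_smul]
  have e1 : (oN β km)⁻¹ * ((oN β b)⁻¹ * oN β km) = (oN β b)⁻¹ := by field_simp
  have e2 : (oN β km)⁻¹ * ((oN β b)⁻¹ * oN β b) = (oN β km)⁻¹ := by field_simp
  simp only [e1, e2]
  abel
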